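/- arXiv:2405.20936 — 6 statements merged into one kernel-verified Lean document; each statement's English description precedes it below -/
import Mathlib

section
/- For every integer d ≥ 3 and every matrix M ∈ M_d, any three distinct columns of M, viewed as vectors in ℝ^d, are linearly independent; equivalently, the Kruskal rank of M is at least 3 (and hence rank(M) ≥ 3). -/
open scoped BigOperators

namespace MClass

/-- The real value (0 or 1) of a Boolean entry. -/
def bR (b : Bool) : ℝ := if b then 1 else 0

/-- The natural-number value (0 or 1) of a Boolean entry. -/
def bN (b : Bool) : ℕ := if b then 1 else 0

/-- The class `ℳ_d` of binary square matrices: unit diagonal, and the off-diagonal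
parts of `∑_{(i,j) ∈ S} (m_i m_jᵀ + m_j m_iᵀ)` distinguish distinct sets `S` of
pairs `i < j` (here `m_i` denotes the `i`-th column of `M`). -/
def memM (d : ℕ) (M : Fin d → Fin d → Bool) : Prop :=
  (∀ i, M i i = true) ∧
    ∀ S₁ S₂ : Finset (Fin d × Fin d),
      (∀ e ∈ S₁, e.1 < e.2) → (∀ e ∈ S₂, e.1 < e.2) → S₁ ≠ S₂ →
      ∃ a b : Fin d, a ≠ b ∧
        (∑ e ∈ S₁, (bN (M a e.1) * bN (M b e.2) + bN (M a e.2) * bN (M b e.1))) ≠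
        (∑ e ∈ S₂, (bN (M a e.1) * bN (M b e.2) + bN (M a e.2) * bN (M b e.1)))

/-- A `p × d` binary matrix `A` is admissible if, after a suitable row permutation,
it takes the form `(M M′ B)ᵀ` with `M, M′ ∈ ℳ_d`; i.e. its first block of `d` rows
is `Mᵀ` and its second block is `M′ᵀ`. -/
def Admissible {pp d : ℕ} (hpd : 2 * d ≤ pp) (A : Fin pp → Fin d → Bool) : Prop :=
  ∃ σ : Equiv.Perm (Fin pp),
    memM d (fun s i => A (σ.symm ⟨i.val, by have := i.isLt; omega⟩) s) ∧
    memM d (fun s i => A (σ.symm ⟨d + i.val, by have := i.isLt; omega⟩) s)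

/-- A binary matrix is `S`-sparse if every row has at least `1` and at most `S`
entries equal to one. -/
def SSparse {pp d : ℕ} (S : ℕ) (A : Fin pp → Fin d → Bool) : Prop :=
  ∀ i : Fin pp,
    1 ≤ (Finset.univ.filter fun s => A i s = true).card ∧
      (Finset.univ.filter fun s => A i s = true).card ≤ S


def op {d : ℕ} (p q : Fin d) : Fin d × Fin d := if p < q then (p, q) else (q, p)

theorem op_lt {d : ℕ} {p q : Fin d} (h : p ≠ q) : (op p q).1 < (op p q).2 := by
  unfold op
  split_ifs with h1
  · exact h1
  · exact lt_of_le_of_ne (not_lt.mp h1) h.symm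

theorem op_inj {d : ℕ} {p q w : Fin d} (h : op p w = op q w) : p = q := by
  unfold op at h
  split_ifs at h with h1 h2 h2 <;> simp only [Prod.mk.injEq] at h
  · exact h.1
  · exact h.1.trans h.2
  · exact h.2.trans h.1
  · exact h.2

theorem op_val {d : ℕ} (M : Fin d → Fin d → Bool) (a b p q : Fin d) :
    bN (M a (op p q).1) * bN (M b (op p q).2) + bN (M a (op p q).2) * bN (M b (op p q).1)
      = bN (M a p) * bN (M b q) + bN (M a q) * bN (M b p) := by
  unfold op
  split_ifs
  · rfl
  · exact add_comm _ _

theorem two_ne {d : ℕ} {M : Fin d → Fin d → Bool} (hM : memM d M) {p q w : Fin d}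
    (hpq : p ≠ q) (hp : p ≠ w) (hq : q ≠ w) :
    ∃ a b : Fin d, a ≠ b ∧
      bN (M a p) * bN (M b w) + bN (M a w) * bN (M b p) ≠
      bN (M a q) * bN (M b w) + bN (M a w) * bN (M b q) := by
  obtain ⟨a, b, hab, h⟩ := hM.2 {op p w} {op q w} (by simpa using op_lt hp)
    (by simpa using op_lt hq) (by
      intro h
      exact hpq (op_inj (Finset.singleton_injective h)))
  rw [Finset.sum_singleton, Finset.sum_singleton, op_val, op_val] at h
  exact ⟨a, b, hab, h⟩

theorem col_ne {d : ℕ} (hd : 3 ≤ d) {M : Fin d → Fin d → Bool} (hM : memM d M) {p q w : Fin d}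
    (hpq : p ≠ q) (hp : p ≠ w) (hq : q ≠ w) : ∃ a, M a p ≠ M a q := by
  by_contra! hc
  obtain ⟨a, b, -, h⟩ := two_ne hM hpq hp hq
  rw [hc a, hc b] at h
  exact h rfl

theorem single_aux {d : ℕ} {M : Fin d → Fin d → Bool} (hM : memM d M) {i j l : Fin d}
    (hij : i ≠ j) (hil : i ≠ l) (hjl : j ≠ l)
    (hs : ∀ a, bN (M a i) = bN (M a j) + bN (M a l))
    (hz : ∀ a, a ≠ l → bN (M a l) = 0) : False := by
  obtain ⟨a, b, hab, h⟩ := two_ne hM hij hil hjl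
  apply h
  rw [hs a, hs b]
  by_cases ha : a = l
  · have := hz b (fun hb => hab (ha.trans hb.symm))
    rw [this]; ring
  · rw [hz a ha]; ring

theorem bN_true : bN true = 1 := rfl

theorem bN_le (b : Bool) : bN b ≤ 1 := by cases b <;> simp [bN]

theorem sum_ne {d : ℕ} {M : Fin d → Fin d → Bool} (hM : memM d M) {i j l : Fin d}
    (hij : i ≠ j) (hil : i ≠ l) (hjl : j ≠ l) :
    ∃ a, bN (M a i) ≠ bN (M a j) + bN (M a l) := by
  by_contra! hs
  by_cases hw : ∃ w, w ≠ i ∧ w ≠ j ∧ w ≠ l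
  · obtain ⟨w, hwi, hwj, hwl⟩ := hw
    have hne : op j w ≠ op l w := fun h => hjl (op_inj h)
    obtain ⟨a, b, -, h⟩ := hM.2 {op i w} {op j w, op l w} (by simpa using op_lt hwi.symm)
      (by simpa using ⟨op_lt hwj.symm, op_lt hwl.symm⟩) (by
        intro h
        have : op j w ∈ ({op i w} : Finset (Fin d × Fin d)) := by rw [h]; simp
        exact hij (op_inj (Finset.mem_singleton.mp this)).symm)
    rw [Finset.sum_singleton, Finset.sum_pair hne, op_val, op_val, op_val, hs a, hs b] at h
    exact h (by ring)
  · push Not at hw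
    have hi := hs i
    have hj := hs j
    have hl := hs l
    rw [hM.1 i, bN_true] at hi
    rw [hM.1 j, bN_true] at hj
    rw [hM.1 l, bN_true] at hl
    have h1 := bN_le (M j i)
    have h2 := bN_le (M l i)
    by_cases hc : bN (M i l) = 0
    · refine single_aux hM hij hil hjl hs ?_
      intro a ha
      by_cases hai : a = i
      · rw [hai]; exact hc
      · by_cases haj : a = j
        · rw [haj]; omega
        · exact absurd (hw a hai haj) ha
    · refine single_aux hM hil hij hjl.symm (fun a => (hs a).trans (add_comm _ _)) ?_
      intro a ha
      by_cases hai : a = i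
      · rw [hai]; omega
      · have : a = l := hw a hai ha
        rw [this]; omega

theorem coef_zero {d : ℕ} (hd : 3 ≤ d) {M : Fin d → Fin d → Bool} (hM : memM d M) {i j l : Fin d}
    (hij : i ≠ j) (hil : i ≠ l) (hjl : j ≠ l) (a b c : ℝ)
    (h : ∀ t, a * bR (M t i) + b * bR (M t j) + c * bR (M t l) = 0) : a = 0 := by
  by_contra ha
  obtain ⟨t1, n1⟩ := col_ne hd hM hij hil hjl
  obtain ⟨t2, n2⟩ := col_ne hd hM hil hij hjl.symm
  obtain ⟨s1, m1⟩ := sum_ne hM hij hil hjl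
  obtain ⟨s2, m2⟩ := sum_ne hM hij.symm hjl hil
  obtain ⟨s3, m3⟩ := sum_ne hM hil.symm hjl.symm hij
  have hi := h i
  have hj := h j
  have hl := h l
  have e1 := h t1
  have e2 := h t2
  have f1 := h s1
  have f2 := h s2
  have f3 := h s3
  rw [hM.1] at hi hj hl
  have key1 : b = 0 → False := by
    intro hb
    have hc : c = -a := by
      cases h1 : M i l <;> simp [bR, h1, hb] at hi <;> first | exact absurd hi ha | linarith
    subst hb hc
    cases h1 : M t2 i <;> cases h2 : M t2 l <;> simp_all [bR]
  have key2 : c = 0 → False := by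
    intro hb
    have hc : b = -a := by
      cases h1 : M i j <;> simp [bR, h1, hb] at hi <;> first | exact absurd hi ha | linarith
    subst hb hc
    cases h1 : M t1 i <;> cases h2 : M t1 j <;> simp_all [bR]
  have k1 : b = -a → c = -a → False := by
    intro hb hc
    subst hb hc
    clear hi hj hl e1 e2 f2 f3 n1 n2 m2 m3
    cases h1 : M s1 i <;> cases h2 : M s1 j <;> cases h3 : M s1 l <;>
      simp [bR, bN, h1, h2, h3] at f1 m1 <;> first | exact ha f1 | (apply ha; linarith)
  have k2 : b = -a → c = a → False := by
    intro hb hc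
    subst hb hc
    clear hi hj hl e1 e2 f1 f3 n1 n2 m1 m3
    cases h1 : M s2 i <;> cases h2 : M s2 j <;> cases h3 : M s2 l <;>
      simp [bR, bN, h1, h2, h3] at f2 m2 <;> first | exact ha f2 | (apply ha; linarith)
  have k3 : b = a → c = -a → False := by
    intro hb hc
    subst hb hc
    clear hi hj hl e1 e2 f2 f1 n1 n2 m2 m1
    cases h1 : M s3 i <;> cases h2 : M s3 j <;> cases h3 : M s3 l <;>
      simp [bR, bN, h1, h2, h3] at f3 m3 <;> first | exact ha f3 | (apply ha; linarith)
  clear f1 f2 f3 m1 m2 m3 e2 n2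
  by_cases hb : b = -a
  · cases h1 : M l i <;> cases h2 : M l j <;> simp [bR, h1, h2] at hl
    · exact key2 hl
    · exact k2 hb (by linarith)
    · exact k1 hb (by linarith)
    · exact key2 (by linarith)
  · by_cases hc : c = -a
    · cases h1 : M j i <;> cases h2 : M j l <;> simp [bR, h1, h2] at hj
      · exact key1 hj
      · exact k3 (by linarith) hc
      · exact hb (by linarith)
      · exact key1 (by linarith)
    · have hsum : a + b + c = 0 := by
        cases h1 : M i j <;> cases h2 : M i l <;> simp [bR, h1, h2] at hi
        · exact absurd hi ha
        · exact absurd (by linarith) hc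
        · exact absurd (by linarith) hb
        · exact hi
      cases h1 : M t1 i <;> cases h2 : M t1 j <;> cases h3 : M t1 l <;>
        simp [bR, h1, h2, h3] at e1 n1
      · exact key1 e1
      · exact ha (by linarith)
      · exact ha e1
      · exact hc (by linarith)

/-- For every `d ≥ 3` and every `M ∈ ℳ_d`, any three distinct
columns of `M`, viewed as vectors of `ℝ^d`, are linearly independent (i.e. the
Kruskal rank of `M` is at least `3`, and hence `rank M ≥ 3`). -/
theorem memM_kruskal_rank_three (d : ℕ) (hd : 3 ≤ d)
    (M : Fin d → Fin d → Bool) (hM : memM d M) :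
    ∀ i j l : Fin d, i ≠ j → i ≠ l → j ≠ l →
      LinearIndependent ℝ
        ![fun a => bR (M a i), fun a => bR (M a j), fun a => bR (M a l)] := by
  intro i j l hij hil hjl
  rw [Fintype.linearIndependent_iff]
  intro g hg
  have h : ∀ t, g 0 * bR (M t i) + g 1 * bR (M t j) + g 2 * bR (M t l) = 0 := by
    intro t
    have := congrFun hg t
    simpa [Fin.sum_univ_three] using this
  have h0 := coef_zero hd hM hij hil hjl (g 0) (g 1) (g 2) h
  have h1 := coef_zero hd hM hij.symm hjl hil (g 1) (g 0) (g 2) (fun t => by linarith [h t])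
  have h2 := coef_zero hd hM hil.symm hjl.symm hij (g 2) (g 0) (g 1) (fun t => by linarith [h t])
  intro k
  fin_cases k
  · exact h0
  · exact h1
  · exact h2

end MClass
end

section
/- Let S ∈ {1, 2}, let d ≥ 3 and p ≥ 2d, and let A be a p × d matrix with entries in {0,1} that is admissible and S-sparse. Then the columns of A are pairwise distinct. -/
open scoped BigOperators

namespace MClass

/-- **Lemma 9 of the paper.**  Let `S ∈ {1, 2}`, `d ≥ 3` and
`p ≥ 2d`.  If a `p × d` binary matrix `A` is admissible and `S`-sparse, then its
columns are pairwise distinct. -/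
theorem admissible_sparse_columns_distinct (S : ℕ) (hS : S = 1 ∨ S = 2)
    (d pp : ℕ) (hd : 3 ≤ d) (hpd : 2 * d ≤ pp)
    (A : Fin pp → Fin d → Bool) (hadm : Admissible hpd A) (hsp : SSparse S A) :
    ∀ s t : Fin d, s ≠ t → (fun i => A i s) ≠ (fun i => A i t) := by
  intro s t hst heq
  obtain ⟨σ, ⟨hdiag, hM⟩, -⟩ := hadm
  have hA : ∀ i, A i s = A i t := fun i => congrFun heq i
  have key : ∀ i, A i s = true → ∀ a, A i a = true → a = s ∨ a = t := by
    intro i h1 a ha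
    by_contra hcon
    push Not at hcon
    have h2 : A i t = true := (hA i) ▸ h1
    have hsub : ({a, s, t} : Finset (Fin d)) ⊆ Finset.univ.filter fun s => A i s = true := by
      intro x hx
      simp only [Finset.mem_insert, Finset.mem_singleton] at hx
      rcases hx with rfl | rfl | rfl <;> simp [*]
    have h3 := Finset.card_le_card hsub
    have h4 : ({a, s, t} : Finset (Fin d)).card = 3 :=
      Finset.card_eq_three.mpr ⟨a, s, t, hcon.1, hcon.2, hst, rfl⟩
    have h5 := (hsp i).2
    omega
  obtain ⟨r, hr⟩ : ∃ r : Fin d, r ∉ ({s, t} : Finset (Fin d)) := by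
    by_contra hcon
    push Not at hcon
    have h1 : (Finset.univ : Finset (Fin d)) ⊆ {s, t} := fun x _ => hcon x
    have h2 := Finset.card_le_card h1
    have h3 : ({s, t} : Finset (Fin d)).card ≤ 2 := Finset.card_le_two
    simp only [Finset.card_univ, Fintype.card_fin] at h2
    omega
  simp only [Finset.mem_insert, Finset.mem_singleton, not_or] at hr
  obtain ⟨hrs, hrt⟩ := hr
  have hs := hdiag s
  have ht := hdiag t
  generalize hN : (fun s i : Fin d => A (σ.symm ⟨i.val, by have := i.isLt; omega⟩) s) = N at hM
  have hNe : ∀ a i, N a i = A (σ.symm ⟨i.val, by have := i.isLt; omega⟩) a := by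
    intro a i; rw [← hN]
  have hcol : ∀ a, N a s = N a t := by
    intro a
    rw [hNe, hNe, Bool.eq_iff_iff]
    have hs' := (hA _).symm.trans hs
    have ht' := (hA _).trans ht
    constructor
    · intro h
      rcases key _ hs a h with rfl | rfl
      · exact ht'
      · exact ht
    · intro h
      rcases key _ ht' a h with rfl | rfl
      · exact hs
      · exact hs'
  have main : ∀ x : Fin d, ∀ a b : Fin d,
      ∑ e ∈ {(min x r, max x r)}, (bN (N a e.1) * bN (N b e.2) + bN (N a e.2) * bN (N b e.1))
        = bN (N a x) * bN (N b r) + bN (N a r) * bN (N b x) := by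
    intro x a b
    rw [Finset.sum_singleton]
    rcases le_total x r with h | h
    · simp [h]
    · simp [h, add_comm]
  obtain ⟨a, b, -, hab⟩ := hM {(min s r, max s r)} {(min t r, max t r)}
    (by simpa using hrs) (by simpa using hrt)
    (by
      intro h
      have h := Finset.singleton_injective h
      rw [Prod.mk.injEq] at h
      obtain ⟨h1, h2⟩ := h
      apply hst
      rcases le_total s r with h3 | h3 <;> rcases le_total t r with h4 | h4 <;>
        simp [h3, h4] at h1 h2 <;> simp_all)
  apply hab
  rw [main, main, hcol, hcol]

end MClass
end

section
/- Let S ∈ {1, 2}, let d ≥ 4 and p ≥ 2d, and let A be a p × d matrix with entries in {0,1} that is admissible and S-sparse. If no column of A has all entries equal to 1, then there exist row indices i_0 < j_0 such that a_{i_0} ∗ a_{j_0} = 0, i.e., rows i_0 and j_0 of A have disjoint supports. -/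
open scoped BigOperators

namespace MClass

/-- **Lemma 10 of the paper.**  Let `S ∈ {1, 2}`, `d ≥ 4` and
`p ≥ 2d`, and let `A` be a `p × d` binary matrix that is admissible and `S`-sparse.
If no column of `A` is all ones, then two rows of `A` have disjoint supports, i.e.
`a_{i₀} ∗ a_{j₀} = 0` for some `i₀ < j₀`. -/
theorem admissible_sparse_disjoint_rows (S : ℕ) (hS : S = 1 ∨ S = 2)
    (d pp : ℕ) (hd : 4 ≤ d) (hpd : 2 * d ≤ pp)
    (A : Fin pp → Fin d → Bool) (hadm : Admissible hpd A) (hsp : SSparse S A)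
    (hcol : ∀ s : Fin d, ∃ i, A i s = false) :
    ∃ i₀ j₀ : Fin pp, i₀ < j₀ ∧ ∀ s, (A i₀ s && A j₀ s) = false := by
  classical
  obtain ⟨σ, ⟨hdiag, -⟩, -⟩ := hadm
  have hcov : ∀ s : Fin d, ∃ i, A i s = true := fun s => ⟨_, hdiag s⟩
  have hrow : ∀ i, ∃ x y, ∀ s, A i s = true ↔ (s = x ∨ s = y) := by
    intro i
    obtain ⟨h1, h2⟩ := hsp i
    have h3 : (Finset.univ.filter fun s => A i s = true).card = 1 ∨
        (Finset.univ.filter fun s => A i s = true).card = 2 := by omega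
    rcases h3 with h3 | h3
    · obtain ⟨x, hx⟩ := Finset.card_eq_one.mp h3
      refine ⟨x, x, fun s => ?_⟩
      have := Finset.ext_iff.mp hx s
      simpa using this
    · obtain ⟨x, y, -, hx⟩ := Finset.card_eq_two.mp h3
      refine ⟨x, y, fun s => ?_⟩
      have := Finset.ext_iff.mp hx s
      simpa using this
  by_contra hcon
  have hint : ∀ i j, ∃ s, A i s = true ∧ A j s = true := by
    intro i j
    by_contra hne
    push Not at hne
    rcases lt_trichotomy i j with h | h | h
    · exact hcon ⟨i, j, h, fun s => by have := hne s; grind⟩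
    · subst h
      obtain ⟨x, y, hxy⟩ := hrow i
      exact hne x ((hxy x).2 (Or.inl rfl)) ((hxy x).2 (Or.inl rfl))
    · exact hcon ⟨j, i, h, fun s => by have := hne s; grind⟩
  have hex : ∀ t : Finset (Fin d), t.card ≤ 3 → ∃ c, c ∉ t := by
    intro t ht
    by_contra h
    push Not at h
    have := Finset.eq_univ_of_forall h
    rw [this, Finset.card_univ, Fintype.card_fin] at ht
    omega
  choose x y hxy using hrow
  have key : ∀ a b c e : Fin d, ∀ i j k, c ≠ a → c ≠ b → e ≠ a → e ≠ b → e ≠ c →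
      (∀ s, A i s = true ↔ s = a ∨ s = b) → (∀ s, A j s = true ↔ s = c ∨ s = a) →
      (∀ s, A k s = true ↔ s = e ∨ s = a) → False := by
    intro a b c e i j k h1 h2 h3 h4 h5 hi hj hk
    obtain ⟨l, hl⟩ := hcol a
    have hla : ¬ A l a = true := by simp [hl]
    obtain ⟨s, hs, hs'⟩ := hint l i
    obtain ⟨t, ht, ht'⟩ := hint l j
    obtain ⟨u, hu, hu'⟩ := hint l k
    rw [hi] at hs'
    rw [hj] at ht'
    rw [hk] at hu'
    have := hxy l
    grind
  let i : Fin pp := ⟨0, by omega⟩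
  obtain ⟨c, hc⟩ := hex {x i, y i} (Finset.card_le_two.trans (by norm_num))
  obtain ⟨e, he⟩ := hex {x i, y i, c} Finset.card_le_three
  simp only [Finset.mem_insert, Finset.mem_singleton, not_or] at hc he
  obtain ⟨j, hj⟩ := hcov c
  obtain ⟨k, hk⟩ := hcov e
  obtain ⟨s, hs, hs'⟩ := hint i j
  obtain ⟨t, ht, ht'⟩ := hint i k
  obtain ⟨u, hu, hu'⟩ := hint j k
  have hi' := hxy i
  have hs1 := (hi' s).1 hs
  have ht1 := (hi' t).1 ht
  have hj' : ∀ v, A j v = true ↔ v = c ∨ v = s := by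
    have := hxy j
    intro v
    grind
  have hk' : ∀ v, A k v = true ↔ v = e ∨ v = t := by
    have := hxy k
    intro v
    grind
  have hst : s = t := by
    rw [hj'] at hu
    rw [hk'] at hu'
    grind
  subst hst
  rcases hs1 with h | h
  · rw [h] at hj' hk'
    exact key _ _ c e i j k hc.1 hc.2 he.1 he.2.1 he.2.2 hi' hj' hk'
  · rw [h] at hj' hk'
    exact key _ _ c e i j k hc.2 hc.1 he.2.1 he.1 he.2.2
      (fun v => (hi' v).trans or_comm) hj' hk'

end MClass
end

section
/- Let S ∈ {1, 2}, let d ≥ 1 and p ≥ 2d, and let A be a p × d matrix with entries in {0,1} that is admissible and S-sparse and whose columns are pairwise distinct. Then for every column index r ∈ {1,…,d}, at least one of the following holds: (i) there exist row indices i < j such that a_i ∗ a_j = e_r; (ii) there exist a column index s ≠ r and three distinct row indices i, j, ℓ such that a_i ∗ a_j = e_r + e_s and a_i ∗ a_ℓ = e_s. -/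
open scoped BigOperators

namespace MClass

/-- **Lemma 11 of the paper.**  Let `S ∈ {1, 2}`, `d ≥ 1` and
`p ≥ 2d`, and let `A` be a `p × d` binary matrix that is admissible, `S`-sparse and
has pairwise distinct columns.  Then for every column index `r`, either
(i) some Hadamard product of two rows equals `e_r`, or (ii) there are a column
`s ≠ r` and rows `i, j, ℓ` with `a_i ∗ a_j = e_r + e_s` and `a_i ∗ a_ℓ = e_s`. -/
theorem admissible_sparse_column_recovery (S : ℕ) (hS : S = 1 ∨ S = 2)
    (d pp : ℕ) (hd : 1 ≤ d) (hpd : 2 * d ≤ pp)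
    (A : Fin pp → Fin d → Bool) (hadm : Admissible hpd A) (hsp : SSparse S A)
    (hcols : ∀ s t : Fin d, s ≠ t → (fun i => A i s) ≠ (fun i => A i t)) :
    ∀ r : Fin d,
      (∃ i j : Fin pp, i < j ∧ ∀ u, (A i u && A j u) = decide (u = r)) ∨
      (∃ s : Fin d, s ≠ r ∧ ∃ i j l : Fin pp, i ≠ j ∧ i ≠ l ∧ j ≠ l ∧
        (∀ u, (A i u && A j u) = (decide (u = r) || decide (u = s))) ∧
        (∀ u, (A i u && A l u) = decide (u = s))) := by
  intro r
  obtain ⟨σ, ⟨h1, -⟩, ⟨h2, -⟩⟩ := hadm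
  have h1r := h1 r
  have h2r := h2 r
  simp only at h1r h2r
  have hne : σ.symm ⟨r.val, by have := r.isLt; omega⟩ ≠
      σ.symm ⟨d + r.val, by have := r.isLt; omega⟩ := by
    intro h
    have h' := congrArg Fin.val (σ.symm.injective h)
    simp only at h'
    omega
  generalize σ.symm ⟨r.val, _⟩ = i at h1r hne
  generalize σ.symm ⟨d + r.val, _⟩ = j at h2r hne
  -- each row has at most two ones
  have key : ∀ (i : Fin pp) (a b c : Fin d), A i a = true → A i b = true → A i c = true →
      a ≠ b → c = a ∨ c = b := by
    intro i a b c ha hb hc hab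
    by_contra hcon
    push Not at hcon
    have hle := (hsp i).2
    have hsub : ({a, b, c} : Finset (Fin d)) ⊆ Finset.univ.filter fun s => A i s = true := by
      intro x hx
      simp only [Finset.mem_insert, Finset.mem_singleton] at hx
      rcases hx with rfl | rfl | rfl <;> simp [*]
    have h3 : ({a, b, c} : Finset (Fin d)).card = 3 :=
      Finset.card_eq_three.mpr ⟨a, b, c, hab, hcon.1.symm, hcon.2.symm, rfl⟩
    have := Finset.card_le_card hsub
    omega
  -- an unordered version of (i) suffices
  have ord : ∀ i j : Fin pp, i ≠ j → (∀ u, (A i u && A j u) = decide (u = r)) →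
      ∃ i j : Fin pp, i < j ∧ ∀ u, (A i u && A j u) = decide (u = r) := by
    intro i j hij h
    rcases lt_or_gt_of_ne hij with hlt | hlt
    · exact ⟨i, j, hlt, h⟩
    · exact ⟨j, i, hlt, fun u => by rw [Bool.and_comm]; exact h u⟩
  by_cases hs : ∃ s, s ≠ r ∧ A i s = true ∧ A j s = true
  · obtain ⟨s, hsr, his, hjs⟩ := hs
    have hi : ∀ u, A i u = (decide (u = r) || decide (u = s)) := by
      intro u
      have := key i r s u h1r his
      by_cases hur : u = r
      · subst hur; simp [h1r]
      · by_cases hus : u = s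
        · subst hus; simp [his]
        · grind
    have hj : ∀ u, A j u = (decide (u = r) || decide (u = s)) := by
      intro u
      have := key j r s u h2r hjs
      by_cases hur : u = r
      · subst hur; simp [h2r]
      · by_cases hus : u = s
        · subst hus; simp [hjs]
        · grind
    obtain ⟨l, hl⟩ := Function.ne_iff.mp (hcols r s hsr.symm)
    have hil : i ≠ l := by rintro rfl; simp [h1r, his] at hl
    have hjl : j ≠ l := by rintro rfl; simp [h2r, hjs] at hl
    by_cases hlr : A l r = true
    · left
      refine ord i l hil fun u => ?_
      rw [hi u]
      grind
    · right
      refine ⟨s, hsr, i, j, l, hne, hil, hjl, fun u => ?_, fun u => ?_⟩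
      · rw [hi u, hj u]; simp
      · rw [hi u]; grind
  · left
    refine ord i j hne fun u => ?_
    by_cases hur : u = r
    · subst hur; simp [h1r, h2r]
    · grind

end MClass
end

section
/- Let S ∈ {1, 2}, let d ≥ 1 and p ≥ 2d, and let A be a p × d matrix with entries in {0,1} that is admissible and S-sparse and whose columns are pairwise distinct. Then there exist d pairs of row indices (i_1, j_1), …, (i_d, j_d) with i_r < j_r for each r, such that the d × d matrix G whose r-th column is a_{i_r} ∗ a_{j_r} is invertible. -/
open scoped BigOperators

namespace MClass

theorem exists_det_ne {ι : Type} {d : ℕ} (v : ι → Fin d → ℝ)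
    (h : ∀ r : Fin d, (Pi.single r 1 : Fin d → ℝ) ∈ Submodule.span ℝ (Set.range v)) :
    ∃ a : Fin d → ι, (Matrix.of fun s r : Fin d => v (a r) s).det ≠ 0 := by
  have htop : Submodule.span ℝ (Set.range v) = ⊤ := by
    rw [eq_top_iff, ← (Pi.basisFun ℝ (Fin d)).span_eq, Submodule.span_le]
    rintro _ ⟨r, rfl⟩
    simpa using h r
  obtain ⟨κ, a, -, hs, hl⟩ := exists_linearIndependent' ℝ v
  rw [htop] at hs
  let b := Module.Basis.mk hl hs.ge
  let e := b.indexEquiv (Pi.basisFun ℝ (Fin d))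
  refine ⟨a ∘ e.symm, ?_⟩
  have hl2 : LinearIndependent ℝ ((v ∘ a) ∘ e.symm) := hl.comp _ e.symm.injective
  have h3 : IsUnit (Matrix.of fun s r : Fin d => v ((a ∘ e.symm) r) s) := by
    rw [← Matrix.linearIndependent_cols_iff_isUnit]
    exact hl2
  rw [Matrix.isUnit_iff_isUnit_det] at h3
  exact h3.ne_zero

theorem card_two {d : ℕ} (f : Fin d → Bool)
    (hc : (Finset.univ.filter fun s => f s = true).card ≤ 2) {r k s : Fin d}
    (hrk : k ≠ r) (hr : f r = true) (hk : f k = true) (hs : f s = true) : s = r ∨ s = k := by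
  by_contra hne
  push Not at hne
  have hsub : ({s, r, k} : Finset (Fin d)) ⊆ Finset.univ.filter fun s => f s = true := by
    intro x hx
    simp only [Finset.mem_insert, Finset.mem_singleton] at hx
    rcases hx with rfl | rfl | rfl <;> simp [*]
  have h1 := Finset.card_le_card hsub
  rw [Finset.card_eq_three.mpr ⟨s, r, k, hne.1, hne.2, hrk.symm, rfl⟩] at h1
  omega

theorem bR_and (a b : Bool) : bR a * bR b = bR (a && b) := by
  cases a <;> cases b <;> simp [bR]

theorem prod_single {d : ℕ} (f g : Fin d → Bool) (r : Fin d)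
    (h : ∀ s, (f s = true ∧ g s = true) ↔ s = r) :
    (fun s => bR (f s) * bR (g s)) = (Pi.single r 1 : Fin d → ℝ) := by
  funext s
  have := h s
  rw [bR_and]
  by_cases hs : s = r
  · subst hs; simp [bR, this]
  · simp only [hs, iff_false] at this
    simp [bR, hs, this]

/-- **Lemma 12 of the paper.**  Let `S ∈ {1, 2}`, `d ≥ 1` and
`p ≥ 2d`, and let `A` be a `p × d` binary matrix that is admissible, `S`-sparse and
has pairwise distinct columns.  Then there are `d` pairs of row indices
`(i_r, j_r)` with `i_r < j_r` such that the `d × d` matrix `G` whose `r`-th column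
is `a_{i_r} ∗ a_{j_r}` is invertible. -/
theorem admissible_sparse_invertible_G (S : ℕ) (hS : S = 1 ∨ S = 2)
    (d pp : ℕ) (hd : 1 ≤ d) (hpd : 2 * d ≤ pp)
    (A : Fin pp → Fin d → Bool) (hadm : Admissible hpd A) (hsp : SSparse S A)
    (hcols : ∀ s t : Fin d, s ≠ t → (fun i => A i s) ≠ (fun i => A i t)) :
    ∃ iR jR : Fin d → Fin pp, (∀ r, iR r < jR r) ∧
      (Matrix.of fun s r : Fin d => bR (A (iR r) s) * bR (A (jR r) s)).det ≠ 0 := by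
  have hsp2 : ∀ i, (Finset.univ.filter fun s => A i s = true).card ≤ 2 := by
    intro i
    have := (hsp i).2
    omega
  obtain ⟨σ, ⟨hM, -⟩, ⟨hM', -⟩⟩ := hadm
  let v : {q : Fin pp × Fin pp // q.1 < q.2} → Fin d → ℝ :=
    fun q s => bR (A q.1.1 s) * bR (A q.1.2 s)
  have hmem : ∀ i j : Fin pp, i ≠ j →
      (fun s => bR (A i s) * bR (A j s)) ∈ Submodule.span ℝ (Set.range v) := by
    intro i j hij
    rcases lt_or_gt_of_ne hij with hlt | hlt
    · exact Submodule.subset_span ⟨⟨(i, j), hlt⟩, rfl⟩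
    · refine Submodule.subset_span ⟨⟨(j, i), hlt⟩, ?_⟩
      funext s
      exact mul_comm _ _
  obtain ⟨a, ha⟩ := exists_det_ne v (by
    intro r
    have h1 := hM r
    have h2 := hM' r
    simp only at h1 h2
    have hne : σ.symm ⟨r.val, by have := r.isLt; omega⟩ ≠
        σ.symm ⟨d + r.val, by have := r.isLt; omega⟩ := by
      intro h
      have := congrArg Fin.val (σ.symm.injective h)
      simp only at this
      omega
    generalize σ.symm ⟨r.val, _⟩ = u at h1 hne
    generalize σ.symm ⟨d + r.val, _⟩ = w at h2 hne
    by_cases hk : ∃ k, k ≠ r ∧ A u k = true ∧ A w k = true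
    · obtain ⟨k, hkr, huk, hwk⟩ := hk
      obtain ⟨i, hi⟩ := Function.ne_iff.mp (hcols r k hkr.symm)
      have hui : u ≠ i := by rintro rfl; simp [h1, huk] at hi
      have hu : ∀ s, A u s = true → s = r ∨ s = k :=
        fun s hs => card_two (A u) (hsp2 u) hkr h1 huk hs
      have hw : ∀ s, A w s = true → s = r ∨ s = k :=
        fun s hs => card_two (A w) (hsp2 w) hkr h2 hwk hs
      have m1 := hmem u i hui
      by_cases hir : A i r = true
      · rw [prod_single (A u) (A i) r] at m1
        · exact m1
        · intro s
          constructor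
          · rintro ⟨p1, p2⟩
            rcases hu s p1 with rfl | rfl
            · rfl
            · simp [hir, p2] at hi
          · rintro rfl; exact ⟨h1, hir⟩
      · have hik : A i k = true := by
          cases hh : A i k <;> simp_all
        rw [prod_single (A u) (A i) k] at m1
        · have m2 := Submodule.sub_mem _ (hmem u w hne) m1
          convert m2 using 1
          funext s
          simp only [Pi.sub_apply, bR_and]
          by_cases hsr : s = r
          · subst hsr; simp [h1, h2, bR, hkr.symm]
          · by_cases hsk : s = k
            · subst hsk; simp [huk, hwk, bR, hsr]
            · have : A u s ≠ true := fun h => by rcases hu s h with h | h <;> contradiction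
              simp [this, bR, hsr, hsk]
        · intro s
          constructor
          · rintro ⟨p1, p2⟩
            rcases hu s p1 with rfl | rfl
            · exact absurd p2 hir
            · rfl
          · rintro rfl; exact ⟨huk, hik⟩
    · have m := hmem u w hne
      rw [prod_single (A u) (A w) r] at m
      · exact m
      · intro s
        constructor
        · rintro ⟨p1, p2⟩
          by_contra hs
          exact hk ⟨s, hs, p1, p2⟩
        · rintro rfl; exact ⟨h1, h2⟩)
  exact ⟨fun r => (a r).1.1, fun r => (a r).1.2, fun r => (a r).2, ha⟩

end MClass
end

section
/- Let S ∈ {1, 2}, let d ≥ 3 and p ≥ 2d, and let A be a p × d matrix with entries in {0,1} that is admissible and S-sparse and whose columns are pairwise distinct. Suppose no column of A has all entries equal to 1. Let D be the (p(p−1)/2) × (1 + d) matrix whose rows are the vectors (1, a_i^⊤ ∗ a_j^⊤) over all pairs 1 ≤ i < j ≤ p. Then rank(D) = d + 1, i.e., D has full column rank. -/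
open scoped BigOperators

namespace MClass

/-- The matrix `D`, whose rows are `(1, a_iᵀ ∗ a_jᵀ)` over all pairs `i < j`. -/
def Dmat {pp d : ℕ} (A : Fin pp → Fin d → Bool) :
    Matrix {e : Fin pp × Fin pp // e.1 < e.2} (Option (Fin d)) ℝ :=
  Matrix.of fun e c =>
    match c with
    | none => 1
    | some s => bR (A e.val.1 s) * bR (A e.val.2 s)

theorem memM_cols_ne {d : ℕ} (hd : 3 ≤ d) {M : Fin d → Fin d → Bool} (h : memM d M)
    {s t : Fin d} (hst : s ≠ t) (he : ∀ a, M a s = M a t) : False := by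
  obtain ⟨u, hus, hut⟩ : ∃ u : Fin d, u ≠ s ∧ u ≠ t := by
    have : ∃ u ∈ (Finset.univ : Finset (Fin d)), u ∉ ({s, t} : Finset (Fin d)) := by
      apply Finset.exists_mem_notMem_of_card_lt_card
      calc _ ≤ 2 := Finset.card_le_two
        _ < _ := by simp; omega
    obtain ⟨u, -, hu⟩ := this
    simp at hu
    exact ⟨u, hu.1, hu.2⟩
  have key := h.2 {(min s u, max s u)} {(min t u, max t u)} (by simp; grind) (by simp; grind)
    (by simp; grind)
  obtain ⟨a, b, hab, hne⟩ := key
  apply hne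
  simp only [Finset.sum_singleton]
  rcases le_total s u with h1 | h1 <;> rcases le_total t u with h2 | h2 <;>
    simp only [h1, h2, min_eq_left, min_eq_right, max_eq_left, max_eq_right, he] <;> ring

theorem not_memM_three {M : Fin 3 → Fin 3 → Bool}
    (hn : ∀ i, ∃ s t, s ≠ t ∧ M s i = true ∧ M t i = true)
    (hf : ∀ i, ∃ s, M s i = false) (h : memM 3 M) : False := by
  have h1 := h.2 {(0, 1)} {(0, 2)} (by simp) (by simp) (by decide)
  have h2 := h.2 {(0, 1)} {(1, 2)} (by simp) (by simp) (by decide)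
  have h3 := h.2 {(0, 2)} {(1, 2)} (by simp) (by simp) (by decide)
  have h0 := h.1
  clear h
  simp only [Finset.sum_singleton] at h1 h2 h3
  revert M
  unfold bN
  decide +kernel

/-- **Lemma 13 of the paper.**  Let `S ∈ {1, 2}`, `d ≥ 3` and
`p ≥ 2d`, and let `A` be a `p × d` binary matrix that is admissible, `S`-sparse and
has pairwise distinct columns, with no all-ones column.  Then the matrix `D` whose
rows are `(1, a_iᵀ ∗ a_jᵀ)` over all pairs `i < j` has full column rank `d + 1`. -/
theorem admissible_sparse_D_full_rank (S : ℕ) (hS : S = 1 ∨ S = 2)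
    (d pp : ℕ) (hd : 3 ≤ d) (hpd : 2 * d ≤ pp)
    (A : Fin pp → Fin d → Bool) (hadm : Admissible hpd A) (hsp : SSparse S A)
    (hcols : ∀ s t : Fin d, s ≠ t → (fun i => A i s) ≠ (fun i => A i t))
    (hcol : ∀ s : Fin d, ∃ i, A i s = false) :
    (Dmat A).rank = d + 1 := by
  obtain ⟨σ, hM, hM'⟩ := hadm
  set r : Fin d → Fin pp := fun i => σ.symm ⟨i.val, by have := i.isLt; omega⟩ with hr
  set r' : Fin d → Fin pp := fun i => σ.symm ⟨d + i.val, by have := i.isLt; omega⟩ with hr'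
  have hrinj : ∀ s t, s ≠ t → r s ≠ r t := by
    intro s t hst h
    simp only [hr, EmbeddingLike.apply_eq_iff_eq, Fin.mk.injEq] at h
    exact hst (Fin.ext h)
  have hrr : ∀ s t, r s ≠ r' t := by
    intro s t h
    simp only [hr, hr', EmbeddingLike.apply_eq_iff_eq, Fin.mk.injEq] at h
    omega
  have hd1 : ∀ s, A (r s) s = true := hM.1
  have hd2 : ∀ s, A (r' s) s = true := hM'.1
  have hne : ∀ i, ∃ s, A i s = true := by
    intro i
    obtain ⟨s, hs⟩ := Finset.card_pos.1 (hsp i).1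
    exact ⟨s, by simpa using hs⟩
  have h3 : ∀ i s t u, A i s = true → A i t = true → A i u = true → s ≠ t → u = s ∨ u = t := by
    intro i s t u hs ht hu hst
    by_contra hcon
    push Not at hcon
    have h2 : (Finset.univ.filter fun s => A i s = true).card ≤ 2 := by
      have := (hsp i).2; omega
    have hsub : ({s, t, u} : Finset (Fin d)) ⊆ Finset.univ.filter fun s => A i s = true := by
      intro x hx
      simp at hx
      rcases hx with rfl | rfl | rfl <;> simpa
    have := Finset.card_le_card hsub
    rw [Finset.card_eq_three.2 ⟨s, t, u, hst, hcon.1.symm, hcon.2.symm, rfl⟩] at this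
    omega
  -- disjoint rows
  have hdis : ∃ i j, i ≠ j ∧ ∀ s, ¬ (A i s = true ∧ A j s = true) := by
    by_contra hcon
    push Not at hcon
    have hint : ∀ i j, ∃ s, A i s = true ∧ A j s = true := by
      intro i j
      by_cases hij : i = j
      · subst hij
        obtain ⟨s, hs⟩ := hne i
        exact ⟨s, hs, hs⟩
      · exact hcon i j hij
    have htwo : ∀ i s, A i s = true → ∃ t, t ≠ s ∧ A i t = true := by
      intro i s hs
      obtain ⟨j, hj⟩ := hcol s
      obtain ⟨t, ht1, ht2⟩ := hint i j
      exact ⟨t, by rintro rfl; simp_all, ht1⟩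
    let z : Fin d := ⟨0, by omega⟩
    obtain ⟨a, haz, ha⟩ := htwo (r z) z (hd1 z)
    obtain ⟨j, hj⟩ := hcol z
    have hja : A j a = true := by
      obtain ⟨t, ht1, ht2⟩ := hint (r z) j
      rcases h3 _ z a t (hd1 z) ha ht1 haz.symm with rfl | rfl
      · simp_all
      · exact ht2
    obtain ⟨b, hba, hb⟩ := htwo j a hja
    have hbz : b ≠ z := by rintro rfl; simp_all
    obtain ⟨k, hk⟩ := hcol a
    have hkz : A k z = true := by
      obtain ⟨t, ht1, ht2⟩ := hint (r z) k
      rcases h3 _ z a t (hd1 z) ha ht1 haz.symm with rfl | rfl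
      · exact ht2
      · simp_all
    have hkb : A k b = true := by
      obtain ⟨t, ht1, ht2⟩ := hint j k
      rcases h3 _ a b t hja hb ht1 hba.symm with rfl | rfl
      · simp_all
      · exact ht2
    have hall : ∀ w, w = z ∨ w = a ∨ w = b := by
      intro w
      by_contra hw
      push Not at hw
      obtain ⟨t1, p1, q1⟩ := hint (r z) (r w)
      obtain ⟨t2, p2, q2⟩ := hint j (r w)
      obtain ⟨t3, p3, q3⟩ := hint k (r w)
      have e1 := h3 _ z a t1 (hd1 z) ha p1 haz.symm
      have e2 := h3 _ a b t2 hja hb p2 hba.symm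
      have e3 := h3 _ z b t3 hkz hkb p3 hbz.symm
      have f12 := h3 (r w) w t1 t2 (hd1 w) q1 q2 (by grind)
      have f13 := h3 (r w) w t1 t3 (hd1 w) q1 q3 (by grind)
      grind
    have hd3 : d = 3 := by
      have : (Finset.univ : Finset (Fin d)) ⊆ {z, a, b} := by
        intro w _
        simpa using hall w
      have := (Finset.card_le_card this).trans Finset.card_le_three
      simp at this
      omega
    subst hd3
    refine not_memM_three ?_ ?_ hM
    · intro i
      obtain ⟨t, ht, ht'⟩ := htwo (r i) i (hd1 i)
      exact ⟨t, i, ht, ht', hd1 i⟩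
    · intro i
      by_contra hcon2
      push Not at hcon2
      have hT : ∀ s, A (r i) s = true := by
        intro s
        have := hcon2 s
        simpa using this
      rcases h3 (r i) 0 1 2 (hT 0) (hT 1) (hT 2) (by decide) with h | h <;>
        exact absurd h (by decide)
  have hinj : Function.Injective (Dmat A).mulVecLin := by
    rw [← LinearMap.ker_eq_bot, LinearMap.ker_eq_bot']
    intro v hv
    have eqlt : ∀ i j, i < j → v none + ∑ s, bR (A i s) * bR (A j s) * v (some s) = 0 := by
      intro i j hij
      have := congrFun hv ⟨(i, j), hij⟩
      simpa [Matrix.mulVec, dotProduct, Dmat, Fintype.sum_option] using this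
    have eq : ∀ i j, i ≠ j → v none + ∑ s, bR (A i s) * bR (A j s) * v (some s) = 0 := by
      intro i j hij
      rcases lt_or_gt_of_ne hij with h | h
      · exact eqlt i j h
      · rw [← eqlt j i h]
        congr 1
        exact Finset.sum_congr rfl fun s _ => by ring
    have hz : ∀ i j s, ¬ (A i s = true ∧ A j s = true) →
        bR (A i s) * bR (A j s) * v (some s) = 0 := by
      intro i j s h
      unfold bR
      cases hi : A i s <;> cases hj : A j s <;> simp_all
    have hone : ∀ i j s, A i s = true → A j s = true →
        bR (A i s) * bR (A j s) * v (some s) = v (some s) := by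
      intro i j s h h'
      simp [bR, h, h']
    have hc : v none = 0 := by
      obtain ⟨i, j, hij, hs⟩ := hdis
      have := eq i j hij
      rw [Finset.sum_eq_zero fun s _ => hz i j s (hs s)] at this
      simpa using this
    have single : ∀ i j s, i ≠ j → A i s = true → A j s = true →
        (∀ t, t ≠ s → ¬ (A i t = true ∧ A j t = true)) → v (some s) = 0 := by
      intro i j s hij hi hj ht
      have := eq i j hij
      rw [Finset.sum_eq_single s (fun t _ hts => hz i j t (ht t hts)) (by simp),
        hone i j s hi hj, hc] at this
      simpa using this
    ext o
    rcases o with _ | s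
    · exact hc
    simp only [Pi.zero_apply]
    by_contra hs
    have hex : ∃ t, t ≠ s ∧ A (r s) t = true ∧ A (r' s) t = true := by
      by_contra hcon
      push Not at hcon
      exact hs (single (r s) (r' s) s (hrr s s) (hd1 s) (hd2 s)
        (fun t ht h => hcon t ht h.1 h.2))
    obtain ⟨t, hts, ht1, ht2⟩ := hex
    have hsum : v (some s) + v (some t) = 0 := by
      have := eq (r s) (r' s) (hrr s s)
      rw [Finset.sum_eq_add s t hts.symm (fun u _ hu => hz _ _ u (by
          rintro ⟨h1, -⟩
          rcases h3 _ s t u (hd1 s) ht1 h1 hts.symm with h | h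
          · exact hu.1 h
          · exact hu.2 h)) (by simp) (by simp),
        hone _ _ s (hd1 s) (hd2 s), hone _ _ t ht1 ht2, hc] at this
      simpa using this
    have htne : v (some t) ≠ 0 := by
      intro h
      apply hs
      linarith
    by_cases hrt : A (r t) s = true
    · refine memM_cols_ne hd hM hts.symm ?_
      intro a
      change A (r s) a = A (r t) a
      rw [Bool.eq_iff_iff]
      constructor
      · intro h
        rcases h3 _ s t a (hd1 s) ht1 h hts.symm with rfl | rfl
        · exact hrt
        · exact hd1 _
      · intro h
        rcases h3 _ s t a hrt (hd1 t) h hts.symm with rfl | rfl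
        · exact hd1 _
        · exact ht1
    · apply htne
      refine single (r s) (r t) t (hrinj s t hts.symm) ht1 (hd1 t) ?_
      rintro u hu ⟨h1, h2⟩
      rcases h3 _ s t u (hd1 s) ht1 h1 hts.symm with rfl | rfl
      · exact hrt h2
      · exact hu rfl
  rw [Matrix.rank, LinearMap.finrank_range_of_inj hinj]
  simp

end MClass
end
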